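/- Let Δ be a simplicial complex on X = {x_1,…,x_n}, K a field, and α = (k_1,…,k_n) ∈ ℕ^n with all k_i ≥ 1. Then for every i ≥ 0, the i-th total Betti numbers agree: β_i(S/J_Δ) = β_i(S^α/J_{Δ^α}), i.e., dim_K Tor_i^S(S/J_Δ, K) = dim_K Tor_i^{S^α}(S^α/J_{Δ^α}, K). -/

import Mathlib

/-- An (abstract) simplicial complex: a collection of finite subsets of the vertex set
closed under taking subsets. -/
def IsComplex {V : Type*} (Δ : Set (Finset V)) : Prop :=
  ∀ ⦃F G : Finset V⦄, F ∈ Δ → G ⊆ F → G ∈ Δ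

/-- `F` is a facet (maximal face) of `Δ`. -/
def IsFacet {V : Type*} (Δ : Set (Finset V)) (F : Finset V) : Prop :=
  F ∈ Δ ∧ ∀ G ∈ Δ, F ⊆ G → F = G

/-- The faces of the expansion `⟨F⟩^α` of the simplex with facet `F`. -/
def simplexExpansion {V : Type*} [DecidableEq V] (F : Finset V) (α : V → ℕ) :
    Set (Finset ((v : V) × Fin (α v))) :=
  {G | G.image Sigma.fst ⊆ F ∧ Set.InjOn Sigma.fst (G : Set ((v : V) × Fin (α v)))}

/-- The expansion `Δ^α` of a simplicial complex `Δ` with respect to `α`. -/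
def expansion {V : Type*} [DecidableEq V] (Δ : Set (Finset V)) (α : V → ℕ) :
    Set (Finset ((v : V) × Fin (α v))) :=
  ⋃ F ∈ Δ, simplexExpansion F α

/-- `P_F`, the ideal generated by the variables belonging to `F`. -/
noncomputable def varIdeal (K : Type) [Field K] {V : Type} (F : Finset V) :
    Ideal (MvPolynomial V K) :=
  Ideal.span (MvPolynomial.X '' (F : Set V))

/-- `J_Δ = ⋂_{F ∈ 𝔉(Δ)} P_F`, the Alexander dual of the facet ideal of `Δ`. -/
noncomputable def dualFacetIdeal (K : Type) [Field K] {V : Type} (Δ : Set (Finset V)) :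
    Ideal (MvPolynomial V K) :=
  ⨅ F ∈ {F | IsFacet Δ F}, varIdeal K F

/-- The irrelevant maximal ideal, generated by all the variables; the quotient by it is a
copy of the residue field `K`. -/
noncomputable def varsIdeal (K : Type) [Field K] (V : Type) : Ideal (MvPolynomial V K) :=
  Ideal.span (Set.range MvPolynomial.X)

/-- The `i`-th total Betti number `β_i(R/I) = dim_K Tor_i^R(R/I, K)` of the quotient of a
polynomial ring `R = K[x_v : v ∈ V]` by an ideal `I`, where `K = R/(x_v : v ∈ V)` is the
residue field (regarded as a `K`-vector space by restriction of scalars along `K → R`). -/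
noncomputable def bettiNumber (K : Type) [Field K] (V : Type) (I : Ideal (MvPolynomial V K))
    (i : ℕ) : Cardinal :=
  Module.rank K (RestrictScalars K (MvPolynomial V K)
    (((CategoryTheory.Tor (ModuleCat (MvPolynomial V K)) i).obj
        (ModuleCat.of (MvPolynomial V K) (MvPolynomial V K ⧸ I))).obj
      (ModuleCat.of (MvPolynomial V K) (MvPolynomial V K ⧸ varsIdeal K V))))

section DerivedFunctors

open CategoryTheory

variable {C C' D E : Type*} [Category* C] [Category* C'] [Category* D] [Category* E]
  [Abelian C] [Abelian C'] [Abelian D] [Abelian E]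
  [HasProjectiveResolutions C] [HasProjectiveResolutions D]

/-- Left derived functors commute with exact functors preserving projective objects. -/
noncomputable def leftDerivedObjIsoOfExact (A : C ⥤ D) (F : D ⥤ E) (G : C ⥤ C') (B : C' ⥤ E)
    [A.Additive] [F.Additive] [G.Additive] [B.Additive] [A.PreservesHomology]
    [A.PreservesProjectiveObjects] [B.PreservesHomology] (e : A ⋙ F ≅ G ⋙ B) (n : ℕ) (X : C) :
    (F.leftDerived n).obj (A.obj X) ≅ B.obj ((G.leftDerived n).obj X) :=
  let P := projectiveResolution X
  (A.mapProjectiveResolution P).isoLeftDerivedObj F n ≪≫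
    (HomologicalComplex.homologyFunctor E _ n).mapIso
      ((NatIso.mapHomologicalComplex e _).app P.complex) ≪≫
    ShortComplex.mapHomologyIso (((G.mapHomologicalComplex _).obj P.complex).sc n) B ≪≫
    B.mapIso (P.isoLeftDerivedObj G n).symm

end DerivedFunctors

section ChangeOfRings

open CategoryTheory

universe u

variable {R S : Type u} [CommRing R] [CommRing S]

lemma Module.Projective.restrictScalars_of_free (R S P : Type*) [CommRing R] [CommRing S]
    [Algebra R S] [AddCommGroup P] [Module R P] [Module S P] [IsScalarTower R S P]
    [Module.Free R S] [Module.Projective S P] : Module.Projective R P := by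
  obtain ⟨s, hs⟩ := Module.projective_def'.mp (inferInstance : Module.Projective S P)
  have : Module.Free R (P →₀ S) := Module.Free.trans (S := S)
  exact Module.Projective.of_split (s.restrictScalars R)
    ((Finsupp.linearCombination S id).restrictScalars R)
    (LinearMap.ext fun x => LinearMap.congr_fun hs x)

lemma restrictScalars_preservesProjectiveObjects [Algebra R S] [Module.Free R S] :
    (ModuleCat.restrictScalars.{u} (algebraMap R S)).PreservesProjectiveObjects where
  projective_obj {P} _ := by
    let : Module R P := Module.compHom P (algebraMap R S)
    have : IsScalarTower R S P := ⟨fun r s x => by rw [Algebra.smul_def, mul_smul]; rfl⟩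
    have : Module.Projective S P := inferInstance
    have := Module.Projective.restrictScalars_of_free R S P
    exact (_root_.IsProjective.iff_projective P).mp this

open TensorProduct in
/-- `(R ⧸ I) ⊗[R] N` and `(S ⧸ I S) ⊗[S] N` are both `N ⧸ I N`. -/
noncomputable def quotTensorEquivMapQuotTensor (R : Type*) {S : Type*} [CommRing R] [CommRing S]
    [Algebra R S] (I : Ideal R)
    (N : Type*) [AddCommGroup N] [Module R N] [Module S N] [IsScalarTower R S N] :
    (R ⧸ I) ⊗[R] N ≃+ (S ⧸ I.map (algebraMap R S)) ⊗[S] N :=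
  (((quotTensorEquivQuotSMul N I).trans
    (Submodule.quotEquivOfEq _ _ (Ideal.smul_restrictScalars I (⊤ : Submodule S N)).symm)).trans
    (Submodule.Quotient.restrictScalarsEquiv R
      (I.map (algebraMap R S) • ⊤ : Submodule S N))).toAddEquiv.trans
    (quotTensorEquivQuotSMul N (I.map (algebraMap R S))).symm.toAddEquiv

open TensorProduct in
lemma quotTensorEquivMapQuotTensor_mk_tmul {R S : Type*} [CommRing R] [CommRing S]
    [Algebra R S] (I : Ideal R)
    {N : Type*} [AddCommGroup N] [Module R N] [Module S N] [IsScalarTower R S N] (r : R) (x : N) :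
    quotTensorEquivMapQuotTensor R (S := S) I N (Ideal.Quotient.mk I r ⊗ₜ[R] x) =
      1 ⊗ₜ[S] (algebraMap R S r • x) := by
  rw [algebraMap_smul]
  rfl

open TensorProduct in
lemma quotTensorEquivMapQuotTensor_smul {R S : Type*} [CommRing R] [CommRing S]
    [Algebra R S] (I : Ideal R)
    {N : Type*} [AddCommGroup N] [Module R N] [Module S N] [IsScalarTower R S N]
    (r : R) (t : (R ⧸ I) ⊗[R] N) :
    quotTensorEquivMapQuotTensor R (S := S) I N (r • t) =
      algebraMap R S r • quotTensorEquivMapQuotTensor R (S := S) I N t := by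
  induction t using TensorProduct.induction_on with
  | zero => simp
  | add x y hx hy => simp [hx, hy]
  | tmul a x =>
    obtain ⟨a, rfl⟩ := Ideal.Quotient.mk_surjective a
    rw [← TensorProduct.tmul_smul, quotTensorEquivMapQuotTensor_mk_tmul,
      quotTensorEquivMapQuotTensor_mk_tmul, ← TensorProduct.tmul_smul,
      ← algebraMap_smul S r x, smul_comm]

open TensorProduct in
lemma quotTensorEquivMapQuotTensor_naturality {R S : Type*} [CommRing R] [CommRing S]
    [Algebra R S] (I : Ideal R)
    {N N' : Type*} [AddCommGroup N] [Module R N] [Module S N] [IsScalarTower R S N]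
    [AddCommGroup N'] [Module R N'] [Module S N'] [IsScalarTower R S N']
    (g : N →ₗ[S] N') (t : (R ⧸ I) ⊗[R] N) :
    quotTensorEquivMapQuotTensor R (S := S) I N' ((g.restrictScalars R).lTensor (R ⧸ I) t) =
      g.lTensor _ (quotTensorEquivMapQuotTensor R (S := S) I N t) := by
  induction t using TensorProduct.induction_on with
  | zero => simp
  | add x y hx hy => simp [hx, hy]
  | tmul a x =>
    obtain ⟨a, rfl⟩ := Ideal.Quotient.mk_surjective a
    simp [quotTensorEquivMapQuotTensor_mk_tmul]

/-- Restricting scalars and tensoring with `R ⧸ I` is tensoring with `S ⧸ I S` and restricting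
scalars. -/
noncomputable def restrictScalarsTensoringLeftIso [Algebra R S] (I : Ideal R) :
    ModuleCat.restrictScalars.{u} (algebraMap R S) ⋙
        (MonoidalCategory.tensoringLeft (ModuleCat.{u} R)).obj (ModuleCat.of R (R ⧸ I)) ≅
      (MonoidalCategory.tensoringLeft (ModuleCat.{u} S)).obj
        (ModuleCat.of S (S ⧸ I.map (algebraMap R S))) ⋙
          ModuleCat.restrictScalars.{u} (algebraMap R S) :=
  NatIso.ofComponents
    (fun N =>
      letI : Module R N := Module.compHom N (algebraMap R S)
      haveI : IsScalarTower R S N := ⟨fun r s x => by rw [Algebra.smul_def, mul_smul]; rfl⟩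
      let q := quotTensorEquivMapQuotTensor R (S := S) I N
      have hsmul := quotTensorEquivMapQuotTensor_smul (S := S) (N := N) I
      let e : ((MonoidalCategory.tensoringLeft (ModuleCat.{u} R)).obj
            (ModuleCat.of R (R ⧸ I))).obj
              ((ModuleCat.restrictScalars.{u} (algebraMap R S)).obj N) ≃ₗ[R]
          (ModuleCat.restrictScalars.{u} (algebraMap R S)).obj
            (((MonoidalCategory.tensoringLeft (ModuleCat.{u} S)).obj
              (ModuleCat.of S (S ⧸ I.map (algebraMap R S)))).obj N) :=
        AddEquiv.toLinearEquiv q hsmul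
      e.toModuleIso)
    (fun {N N'} g => by
      apply ModuleCat.hom_ext
      apply LinearMap.ext
      intro t
      let : Module R N := Module.compHom N (algebraMap R S)
      have : IsScalarTower R S N := ⟨fun r s x => by rw [Algebra.smul_def, mul_smul]; rfl⟩
      let : Module R N' := Module.compHom N' (algebraMap R S)
      have : IsScalarTower R S N' := ⟨fun r s x => by rw [Algebra.smul_def, mul_smul]; rfl⟩
      have h := quotTensorEquivMapQuotTensor_naturality (R := R) I g.hom
      exact h t)

/-- Flat base change for `Tor` along a free ring extension. -/
noncomputable def torRestrictScalarsIso [Algebra R S] [Module.Free R S] (I : Ideal R)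
    (N : ModuleCat.{u} S) (i : ℕ) :
    ((Tor (ModuleCat.{u} R) i).obj (ModuleCat.of R (R ⧸ I))).obj
        ((ModuleCat.restrictScalars.{u} (algebraMap R S)).obj N) ≅
      (ModuleCat.restrictScalars.{u} (algebraMap R S)).obj
        (((Tor (ModuleCat.{u} S) i).obj
          (ModuleCat.of S (S ⧸ I.map (algebraMap R S)))).obj N) :=
  haveI := restrictScalars_preservesProjectiveObjects (R := R) (S := S)
  leftDerivedObjIsoOfExact _ _ _ _ (restrictScalarsTensoringLeftIso (R := R) (S := S) I) i N

end ChangeOfRings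

section BettiNumber

open MvPolynomial

lemma mem_varsIdeal_iff {K : Type} [Field K] {V : Type} (x : MvPolynomial V K) :
    x ∈ varsIdeal K V ↔ constantCoeff x = 0 := by
  rw [varsIdeal, ← Set.image_univ, mem_ideal_span_X_image, constantCoeff_eq]
  constructor
  · intro h
    by_contra h0
    obtain ⟨i, -, hi⟩ := h 0 (mem_support_iff.mpr h0)
    exact hi rfl
  · intro h m hm
    have hm0 : m ≠ 0 := by
      rintro rfl
      exact mem_support_iff.mp hm h
    obtain ⟨i, hi⟩ := Finsupp.ne_iff.mp hm0
    exact ⟨i, trivial, hi⟩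

/-- Total Betti numbers are invariant under extension along a homomorphism of polynomial rings
which is free and compatible with the augmentations. -/
lemma bettiNumber_map {K : Type} [Field K] {V W : Type}
    [Algebra (MvPolynomial V K) (MvPolynomial W K)]
    [IsScalarTower K (MvPolynomial V K) (MvPolynomial W K)]
    [Module.Free (MvPolynomial V K) (MvPolynomial W K)]
    (hc : ∀ x : MvPolynomial V K,
      constantCoeff (algebraMap (MvPolynomial V K) (MvPolynomial W K) x) = constantCoeff x)
    (I : Ideal (MvPolynomial V K)) (i : ℕ) :
    bettiNumber K V I i =
      bettiNumber K W (I.map (algebraMap (MvPolynomial V K) (MvPolynomial W K))) i := by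
  let N := ModuleCat.of (MvPolynomial W K) (MvPolynomial W K ⧸ varsIdeal K W)
  let A := ModuleCat.restrictScalars.{0} (algebraMap (MvPolynomial V K) (MvPolynomial W K))
  let g : MvPolynomial V K →ₗ[MvPolynomial V K] MvPolynomial W K ⧸ varsIdeal K W :=
    Algebra.linearMap _ _
  have hg (x) : g x = Ideal.Quotient.mk _ (algebraMap _ _ x) := rfl
  have hker : varsIdeal K V = LinearMap.ker g := by
    ext x
    rw [LinearMap.mem_ker, hg, Ideal.Quotient.eq_zero_iff_mem, mem_varsIdeal_iff,
      mem_varsIdeal_iff, hc]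
  have hsurj : Function.Surjective g := by
    intro y
    obtain ⟨y, rfl⟩ := Ideal.Quotient.mk_surjective y
    refine ⟨C (constantCoeff y), ?_⟩
    rw [hg, Ideal.Quotient.eq, mem_varsIdeal_iff, map_sub, hc, constantCoeff_C, sub_self]
  let e₀ := (Submodule.quotEquivOfEq _ _ hker).trans (g.quotKerEquivOfSurjective hsurj)
  have he₀ (r : MvPolynomial V K) (x) :
      e₀ (r • x) = algebraMap _ (MvPolynomial W K) r • e₀ x := by
    rw [map_smul, algebraMap_smul]
  let e : (MvPolynomial V K ⧸ varsIdeal K V) ≃ₗ[MvPolynomial V K] A.obj N :=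
    AddEquiv.toLinearEquiv (M₂ := A.obj N) e₀.toAddEquiv he₀
  let t := (((CategoryTheory.Tor (ModuleCat (MvPolynomial V K)) i).obj
        (ModuleCat.of (MvPolynomial V K) (MvPolynomial V K ⧸ I))).mapIso
        e.toModuleIso ≪≫ torRestrictScalarsIso I N i).toLinearEquiv
  refine rank_eq_of_equiv_equiv id t.toAddEquiv Function.bijective_id fun c x => ?_
  refine (t.map_smul (algebraMap K (MvPolynomial V K) c) x).trans ?_
  let T := ((CategoryTheory.Tor (ModuleCat (MvPolynomial W K)) i).obj
    (ModuleCat.of (MvPolynomial W K)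
      (MvPolynomial W K ⧸ I.map (algebraMap (MvPolynomial V K) (MvPolynomial W K))))).obj N
  let y : T := t x
  exact congrArg (· • y)
    (IsScalarTower.algebraMap_apply K (MvPolynomial V K) (MvPolynomial W K) c).symm

end BettiNumber
section Expansion

open MvPolynomial

lemma isFacet_expansion_iff {V : Type*} [DecidableEq V] {α : V → ℕ} (hα : ∀ v, 1 ≤ α v)
    {Δ : Set (Finset V)} (hΔ : IsComplex Δ) {G : Finset ((v : V) × Fin (α v))} :
    IsFacet (expansion Δ α) G ↔
      IsFacet Δ (G.image Sigma.fst) ∧ Set.InjOn Sigma.fst (G : Set ((v : V) × Fin (α v))) := by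
  have hmem (G) : G ∈ expansion Δ α ↔
      G.image Sigma.fst ∈ Δ ∧ Set.InjOn Sigma.fst (G : Set ((v : V) × Fin (α v))) := by
    simp only [expansion, simplexExpansion, Set.mem_iUnion, Set.mem_ofPred_eq, exists_prop]
    exact ⟨fun ⟨F, hF, hGF, hG⟩ => ⟨hΔ hF hGF, hG⟩, fun ⟨h, hG⟩ => ⟨_, h, subset_rfl, hG⟩⟩
  constructor
  · rintro ⟨hG, hmax⟩
    obtain ⟨hGΔ, hinj⟩ := (hmem G).mp hG
    refine ⟨⟨hGΔ, fun H hH hGH => hGH.antisymm fun v hv => ?_⟩, hinj⟩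
    by_contra hvG
    have hnot : (⟨v, ⟨0, hα v⟩⟩ : (v : V) × Fin (α v)) ∉ G := fun h =>
      hvG (Finset.mem_image_of_mem _ h)
    refine hnot ?_
    rw [hmax (insert ⟨v, ⟨0, hα v⟩⟩ G) ((hmem _).mpr ⟨hΔ hH ?_, ?_⟩) (Finset.subset_insert _ _)]
    · exact Finset.mem_insert_self _ _
    · rw [Finset.image_insert]
      exact Finset.insert_subset hv hGH
    · rw [Finset.coe_insert, Set.injOn_insert hnot]
      exact ⟨hinj, by simpa using hvG⟩
  · rintro ⟨⟨hG, hmax⟩, hinj⟩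
    refine ⟨(hmem G).mpr ⟨hG, hinj⟩, fun G' hG' hGG' => hGG'.antisymm fun p hp => ?_⟩
    obtain ⟨hG'Δ, hinj'⟩ := (hmem G').mp hG'
    have hp' := Finset.mem_image_of_mem Sigma.fst hp
    rw [← hmax _ hG'Δ (Finset.image_subset_image hGG')] at hp'
    obtain ⟨r, hr, hrp⟩ := Finset.mem_image.mp hp'
    rwa [← hinj' (hGG' hr) hp hrp]

variable {V : Type} [Finite V] (α : V → ℕ)

/-- The exponent vector on `(v : V) × Fin (α v)` obtained from an exponent vector on `V` by
repeating its value at `v` on all the copies of `v`. -/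
noncomputable def expandExponent :
    (V →₀ ℕ) →+ (((v : V) × Fin (α v)) →₀ ℕ) where
  toFun m := Finsupp.equivFunOnFinite.symm fun p => m p.1
  map_zero' := by ext; rfl
  map_add' _ _ := by ext; rfl

@[simp]
lemma expandExponent_apply (m : V →₀ ℕ) (p : (v : V) × Fin (α v)) :
    expandExponent α m p = m p.1 := rfl

/-- The `K`-algebra homomorphism sending `x_v` to the product of all the copies of `x_v`. -/
noncomputable def expandHom (K : Type) [Field K] :
    MvPolynomial V K →ₐ[K] MvPolynomial ((v : V) × Fin (α v)) K :=
  AddMonoidAlgebra.mapDomainAlgHom K K (expandExponent α)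

lemma expandHom_monomial {K : Type} [Field K] (m : V →₀ ℕ) (c : K) :
    expandHom α K (monomial m c) = monomial (expandExponent α m) c :=
  AddMonoidAlgebra.mapDomain_single

variable {α}

lemma constantCoeff_expandHom (hα : ∀ v, 1 ≤ α v) {K : Type} [Field K] (x : MvPolynomial V K) :
    constantCoeff (expandHom α K x) = constantCoeff x := by
  induction x using MvPolynomial.induction_on' with
  | add p q hp hq => simp [hp, hq]
  | monomial m c =>
    have : expandExponent α m = 0 ↔ m = 0 := by
      refine ⟨fun h => ?_, fun h => by rw [h, map_zero]⟩
      ext v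
      exact DFunLike.congr_fun h ⟨v, ⟨0, hα v⟩⟩
    classical
    simp only [expandHom_monomial, constantCoeff_monomial, this]

lemma exists_expandExponent_add (hα : ∀ v, 1 ≤ α v) (q : ((v : V) × Fin (α v)) →₀ ℕ) :
    ∃ (p : V →₀ ℕ) (t : ((v : V) × Fin (α v)) →₀ ℕ),
      (∀ v, ∃ j, t ⟨v, j⟩ = 0) ∧ expandExponent α p + t = q := by
  have hle (p) : (⨅ j, q ⟨p.1, j⟩) ≤ q p := ciInf_le (OrderBot.bddBelow _) p.2
  refine ⟨Finsupp.equivFunOnFinite.symm fun v => ⨅ j, q ⟨v, j⟩,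
    Finsupp.equivFunOnFinite.symm fun p => q p - ⨅ j, q ⟨p.1, j⟩, fun v => ?_, ?_⟩
  · have : Nonempty (Fin (α v)) := ⟨⟨0, hα v⟩⟩
    obtain ⟨j, hj⟩ := exists_eq_ciInf_of_finite (f := fun j => q ⟨v, j⟩)
    exact ⟨j, by simp [hj]⟩
  · ext p
    simpa using Nat.add_sub_cancel' (hle p)

lemma le_of_expandExponent_add_eq {p p' : V →₀ ℕ} {t t' : ((v : V) × Fin (α v)) →₀ ℕ}
    (ht : ∀ v, ∃ j, t ⟨v, j⟩ = 0) (h : expandExponent α p + t = expandExponent α p' + t') :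
    p' ≤ p := by
  intro v
  obtain ⟨j, hj⟩ := ht v
  have := DFunLike.congr_fun h ⟨v, j⟩
  simp only [Finsupp.add_apply, expandExponent_apply, hj] at this
  lia

lemma expandExponent_add_inj {p p' : V →₀ ℕ} {t t' : ((v : V) × Fin (α v)) →₀ ℕ}
    (ht : ∀ v, ∃ j, t ⟨v, j⟩ = 0) (ht' : ∀ v, ∃ j, t' ⟨v, j⟩ = 0) :
    expandExponent α p + t = expandExponent α p' + t' ↔ p = p' ∧ t = t' := by
  refine ⟨fun h => ?_, fun ⟨h, h'⟩ => by rw [h, h']⟩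
  obtain rfl : p = p' :=
    (le_of_expandExponent_add_eq ht' h.symm).antisymm (le_of_expandExponent_add_eq ht h)
  exact ⟨rfl, add_left_cancel h⟩

/-- The target of `expandHom` has a basis over the source, consisting of the monomials which are
not divisible by all the copies of any variable. -/
lemma free_of_algebraMap_eq_expandHom (hα : ∀ v, 1 ≤ α v) {K : Type} [Field K]
    [Algebra (MvPolynomial V K) (MvPolynomial ((v : V) × Fin (α v)) K)]
    (h : ∀ x : MvPolynomial V K, algebraMap _ _ x = expandHom α K x) :
    Module.Free (MvPolynomial V K) (MvPolynomial ((v : V) × Fin (α v)) K) := by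
  classical
  let T := {t : ((v : V) × Fin (α v)) →₀ ℕ // ∀ v, ∃ j, t ⟨v, j⟩ = 0}
  let L := Finsupp.linearCombination (MvPolynomial V K)
    fun t : T => (monomial t.1 1 : MvPolynomial ((v : V) × Fin (α v)) K)
  have hL (t : T) (p : V →₀ ℕ) (c : K) :
      L (Finsupp.single t (monomial p c)) = monomial (expandExponent α p + t.1) c := by
    simp [L, Algebra.smul_def, h, expandHom_monomial, monomial_mul]
  have hcoeff (g : T →₀ MvPolynomial V K) (t : T) (p : V →₀ ℕ) :
      coeff (expandExponent α p + t.1) (L g) = coeff p (g t) := by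
    induction g using Finsupp.induction_linear with
    | zero => simp
    | add x y hx hy => simp [hx, hy]
    | single s x =>
      induction x using MvPolynomial.induction_on' with
      | add x y hx hy => rw [Finsupp.single_add, map_add, coeff_add, hx, hy]; simp
      | monomial m c =>
        rw [hL, coeff_monomial, Finsupp.single_apply]
        simp only [expandExponent_add_inj s.2 t.2, ← Subtype.ext_iff]
        by_cases hst : s = t <;> simp [hst, coeff_monomial]
  refine Module.Free.of_equiv (LinearEquiv.ofBijective L ⟨?_, ?_⟩)
  · rw [injective_iff_map_eq_zero]
    intro g hg
    ext t p
    rw [← hcoeff, hg]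
    simp
  · intro y
    induction y using MvPolynomial.induction_on' with
    | add x y hx hy =>
      obtain ⟨⟨a, rfl⟩, b, rfl⟩ := hx, hy
      exact ⟨a + b, map_add _ _ _⟩
    | monomial q c =>
      obtain ⟨p, t, ht, rfl⟩ := exists_expandExponent_add hα q
      exact ⟨_, hL ⟨t, ht⟩ p c⟩

lemma mem_dualFacetIdeal_iff {K : Type} [Field K] {W : Type} {Δ : Set (Finset W)}
    {x : MvPolynomial W K} :
    x ∈ dualFacetIdeal K Δ ↔ ∀ m ∈ x.support, ∀ F, IsFacet Δ F → ∃ v ∈ F, m v ≠ 0 := by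
  simp only [dualFacetIdeal, varIdeal, Submodule.mem_iInf, Set.mem_ofPred_eq,
    mem_ideal_span_X_image, Finset.mem_coe]
  exact ⟨fun h m hm F hF => h F hF m hm, fun h F hF m hm => h m hm F hF⟩

lemma monomial_mem_dualFacetIdeal {K : Type} [Field K] {W : Type} {Δ : Set (Finset W)}
    {m : W →₀ ℕ} (h : ∀ F, IsFacet Δ F → ∃ v ∈ F, m v ≠ 0) (c : K) :
    monomial m c ∈ dualFacetIdeal K Δ := by
  rw [mem_dualFacetIdeal_iff]
  intro m' hm'
  rwa [Finset.mem_singleton.mp (support_monomial_subset hm')]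

lemma map_dualFacetIdeal [DecidableEq V] (hα : ∀ v, 1 ≤ α v) (K : Type) [Field K]
    {Δ : Set (Finset V)} (hΔ : IsComplex Δ) :
    (dualFacetIdeal K Δ).map (expandHom α K) = dualFacetIdeal K (expansion Δ α) := by
  apply le_antisymm
  · rw [Ideal.map_le_iff_le_comap]
    intro x hx
    rw [mem_dualFacetIdeal_iff] at hx
    rw [Ideal.mem_comap, x.as_sum, map_sum]
    refine Ideal.sum_mem _ fun m hm => ?_
    rw [expandHom_monomial]
    refine monomial_mem_dualFacetIdeal (fun G hG => ?_) _
    obtain ⟨v, hv, hmv⟩ := hx m hm _ ((isFacet_expansion_iff hα hΔ).mp hG).1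
    obtain ⟨p, hp, rfl⟩ := Finset.mem_image.mp hv
    exact ⟨p, hp, hmv⟩
  · intro y hy
    rw [mem_dualFacetIdeal_iff] at hy
    rw [y.as_sum]
    refine Ideal.sum_mem _ fun q hq => ?_
    specialize hy q hq
    generalize coeff q y = c
    obtain ⟨p, t, ht, rfl⟩ := exists_expandExponent_add hα q
    choose s hs using ht
    have hmul : monomial (expandExponent α p + t) c =
        expandHom α K (monomial p c) * monomial t 1 := by
      rw [expandHom_monomial, monomial_mul, mul_one]
    rw [hmul]
    refine Ideal.mul_mem_right _ _ (Ideal.mem_map_of_mem _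
      (monomial_mem_dualFacetIdeal (fun F hF => ?_) c))
    have himage : (F.image fun v => (⟨v, s v⟩ : (v : V) × Fin (α v))).image Sigma.fst = F := by
      rw [Finset.image_image]
      exact Finset.image_id
    have hfacet : IsFacet (expansion Δ α) (F.image fun v => ⟨v, s v⟩) := by
      refine (isFacet_expansion_iff hα hΔ).mpr ⟨by rwa [himage], ?_⟩
      rw [Finset.coe_image]
      rintro _ ⟨v, -, rfl⟩ _ ⟨w, -, rfl⟩ (rfl : v = w)
      rfl
    obtain ⟨_, hp, hne⟩ := hy _ hfacet
    obtain ⟨v, hv, rfl⟩ := Finset.mem_image.mp hp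
    exact ⟨v, hv, by simpa [hs] using hne⟩

end Expansion

/-- `β_i(S/J_Δ) = β_i(S^α/J_{Δ^α})` for all `i ≥ 0`. -/
theorem bettiNumber_dualFacetIdeal_expansion (n : ℕ) (K : Type) [Field K]
    (Δ : Set (Finset (Fin n))) (hΔ : IsComplex Δ)
    (α : Fin n → ℕ) (hα : ∀ i, 1 ≤ α i) :
    ∀ i : ℕ, bettiNumber K (Fin n) (dualFacetIdeal K Δ) i =
      bettiNumber K ((i : Fin n) × Fin (α i)) (dualFacetIdeal K (expansion Δ α)) i := by
  intro i
  let : Algebra (MvPolynomial (Fin n) K) (MvPolynomial ((i : Fin n) × Fin (α i)) K) :=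
    (expandHom α K).toRingHom.toAlgebra
  have : IsScalarTower K (MvPolynomial (Fin n) K) (MvPolynomial ((i : Fin n) × Fin (α i)) K) :=
    IsScalarTower.of_algebraMap_eq fun c => ((expandHom α K).commutes c).symm
  have := free_of_algebraMap_eq_expandHom hα (K := K) fun _ => rfl
  rw [← map_dualFacetIdeal hα K hΔ]
  exact bettiNumber_map (constantCoeff_expandHom hα) _ i
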